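/- arXiv:2106.01873 — 3 statements merged into one kernel-verified Lean document; each statement's English description precedes it below -/
import Mathlib

section
/- Let f : ℝ² × ℝ → ℝ be smooth (C^∞), with variables written (x,y,z). Assume that for every (x,y,z) with f(x,y,z) = 0 and f_z(x,y,z) = 0 the determinant Δ(x,y,z) = [f_x · f_{yz} − f_y · f_{xz}](x,y,z) is nonzero. Then the discriminant equals the envelope: 𝒟 = ℰ. -/
/-- The partial derivative of a smooth `f` in its last variable is `C¹`. -/
theorem contDiff_deriv_snd {f : (ℝ × ℝ) × ℝ → ℝ} (hf : ContDiff ℝ (⊤ : ℕ∞) f) :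
    ContDiff ℝ 1 fun p : (ℝ × ℝ) × ℝ => deriv (fun t => f (p.1, t)) p.2 := by
  have h : (fun p : (ℝ × ℝ) × ℝ => deriv (fun t => f (p.1, t)) p.2) =
      fun p => fderiv ℝ f p ((0, 0), 1) := by
    funext p
    have h1 : HasFDerivAt f (fderiv ℝ f p) (p.1, p.2) :=
      (hf.differentiable (by simp) p).hasFDerivAt
    have h2 : HasDerivAt (fun t : ℝ => (p.1, t)) (((0, 0) : ℝ × ℝ), (1 : ℝ)) p.2 :=
      (hasDerivAt_const p.2 p.1).prodMk (hasDerivAt_id p.2)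
    exact (h1.comp_hasDerivAt p.2 h2).deriv
  rw [h]
  exact (hf.fderiv_right (m := 1) (by norm_cast)).clm_apply contDiff_const

/-- A point at which two distinct zeros of `f (q, ·)` coalesce lies in the discriminant. -/
theorem eq_zero_and_deriv_eq_zero_of_tendsto {f : (ℝ × ℝ) × ℝ → ℝ}
    (hf : ContDiff ℝ (⊤ : ℕ∞) f) {q : ℝ × ℝ} {qn : ℕ → ℝ × ℝ} {zn zn' : ℕ → ℝ} {zs : ℝ}
    (hq : Filter.Tendsto qn Filter.atTop (nhds q))
    (hz : Filter.Tendsto zn Filter.atTop (nhds zs))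
    (hz' : Filter.Tendsto zn' Filter.atTop (nhds zs))
    (hne : ∀ n, zn n ≠ zn' n) (h0 : ∀ n, f (qn n, zn n) = 0 ∧ f (qn n, zn' n) = 0) :
    f (q, zs) = 0 ∧ deriv (fun t => f (q, t)) zs = 0 := by
  have hrolle : ∀ n, ∃ c ∈ Set.Ioo (min (zn n) (zn' n)) (max (zn n) (zn' n)),
      deriv (fun t => f (qn n, t)) c = 0 := by
    intro n
    have hc : Continuous fun t => f (qn n, t) :=
      hf.continuous.comp (Continuous.prodMk_right (qn n))
    refine exists_deriv_eq_zero (min_lt_max.2 (hne n)) hc.continuousOn ?_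
    rcases le_total (zn n) (zn' n) with h | h <;> simp [h, h0 n]
  choose c hc hc0 using hrolle
  have hclim : Filter.Tendsto c Filter.atTop (nhds zs) :=
    tendsto_of_tendsto_of_tendsto_of_le_of_le (by simpa using hz.min hz')
      (by simpa using hz.max hz') (fun n => (hc n).1.le) (fun n => (hc n).2.le)
  refine ⟨tendsto_nhds_unique ((hf.continuous.tendsto (q, zs)).comp (hq.prodMk_nhds hz)) ?_,
    tendsto_nhds_unique
      (((contDiff_deriv_snd hf).continuous.tendsto (q, zs)).comp (hq.prodMk_nhds hclim)) ?_⟩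
  · exact tendsto_const_nhds.congr fun n => (h0 n).1.symm
  · exact tendsto_const_nhds.congr fun n => (hc0 n).symm

/-- A `C¹` map of the plane with nonzero Jacobian determinant at `(x, y)` has a local right
inverse along the vertical line through the value at `(x, y)`. -/
theorem exists_continuousOn_rightInverse {a b : ℝ × ℝ → ℝ} (ha : ContDiff ℝ 1 a)
    (hb : ContDiff ℝ 1 b) {x y : ℝ} (ha0 : a (x, y) = 0) (hb0 : b (x, y) = 0)
    (hdet : deriv (fun s => a (s, y)) x * deriv (fun s => b (x, s)) y -
      deriv (fun s => a (x, s)) y * deriv (fun s => b (s, y)) x ≠ 0) :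
    ∃ γ : ℝ → ℝ × ℝ, γ 0 = (x, y) ∧ ∃ r > 0, ContinuousOn γ (Metric.ball 0 r) ∧
      ∀ s ∈ Metric.ball (0 : ℝ) r, a (γ s) = 0 ∧ b (γ s) = s := by
  have deriv_fst_eq : ∀ {g : ℝ × ℝ → ℝ}, ContDiff ℝ 1 g →
      deriv (fun s => g (s, y)) x = fderiv ℝ g (x, y) (1, 0) := fun {g} hg =>
    (((hg.differentiable one_ne_zero (x, y)).hasFDerivAt).comp_hasDerivAt x
      ((hasDerivAt_id x).prodMk (hasDerivAt_const x y))).deriv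
  have deriv_snd_eq : ∀ {g : ℝ × ℝ → ℝ}, ContDiff ℝ 1 g →
      deriv (fun s => g (x, s)) y = fderiv ℝ g (x, y) (0, 1) := fun {g} hg =>
    (((hg.differentiable one_ne_zero (x, y)).hasFDerivAt).comp_hasDerivAt y
      ((hasDerivAt_const y x).prodMk (hasDerivAt_id y))).deriv
  rw [deriv_fst_eq ha, deriv_snd_eq ha, deriv_fst_eq hb, deriv_snd_eq hb] at hdet
  set A := fderiv ℝ a (x, y)
  set B := fderiv ℝ b (x, y)
  have expand : ∀ (l : ℝ × ℝ →L[ℝ] ℝ) (w : ℝ × ℝ), l w = w.1 * l (1, 0) + w.2 * l (0, 1) := by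
    intro l w
    rw [← smul_eq_mul, ← smul_eq_mul, ← map_smul, ← map_smul, ← map_add]
    simp
  have hinj : Function.Injective (A.prod B).toLinearMap := by
    rw [← LinearMap.ker_eq_bot, LinearMap.ker_eq_bot']
    intro w hw
    have h1 : A w = 0 := congrArg Prod.fst hw
    have h2 : B w = 0 := congrArg Prod.snd hw
    rw [expand] at h1 h2
    have hu : w.1 * (A (1, 0) * B (0, 1) - A (0, 1) * B (1, 0)) = 0 := by
      linear_combination B (0, 1) * h1 - A (0, 1) * h2
    have hv : w.2 * (A (1, 0) * B (0, 1) - A (0, 1) * B (1, 0)) = 0 := by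
      linear_combination A (1, 0) * h2 - B (1, 0) * h1
    exact Prod.ext ((mul_eq_zero.1 hu).resolve_right hdet)
      ((mul_eq_zero.1 hv).resolve_right hdet)
  let e : (ℝ × ℝ) ≃L[ℝ] ℝ × ℝ :=
    (LinearEquiv.ofInjectiveEndo (A.prod B).toLinearMap hinj).toContinuousLinearEquiv
  have hstrict : HasStrictFDerivAt (fun w => (a w, b w)) (e : ℝ × ℝ →L[ℝ] ℝ × ℝ) (x, y) :=
    (ha.contDiffAt.hasStrictFDerivAt one_ne_zero).prodMk
      (hb.contDiffAt.hasStrictFDerivAt one_ne_zero)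
  let E := hstrict.toOpenPartialHomeomorph _
  have hE : ∀ w, E w = (a w, b w) := fun w => rfl
  have hsource : (x, y) ∈ E.source := hstrict.mem_toOpenPartialHomeomorph_source
  have hE0 : E (x, y) = (0, 0) := by rw [hE, ha0, hb0]
  have htarget : ((0 : ℝ), (0 : ℝ)) ∈ E.target := hE0 ▸ E.map_source hsource
  have hline : Continuous fun s : ℝ => ((0 : ℝ), s) := Continuous.prodMk_right 0
  obtain ⟨r, hr, hball⟩ := Metric.mem_nhds_iff.1
    (hline.continuousAt.preimage_mem_nhds (E.open_target.mem_nhds htarget))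
  refine ⟨fun s => E.symm (0, s), ?_, r, hr,
    E.continuousOn_symm.comp hline.continuousOn hball, fun s hs => ?_⟩
  · change E.symm (0, 0) = _
    rw [← hE0, E.left_inv hsource]
  · have h := E.right_inv (hball hs)
    rw [hE] at h
    exact Prod.ext_iff.1 h

/-- A function vanishing at `z` with positive derivative there is positive just after `z`. -/
theorem eventually_pos_of_deriv_pos {g : ℝ → ℝ} {z : ℝ} (hg : g z = 0) (hd : 0 < deriv g z) :
    ∀ᶠ t in nhdsWithin z (Set.Ioi z), 0 < g t := by
  have h := (hasDerivAt_iff_tendsto_slope.1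
    (differentiableAt_of_deriv_ne_zero hd.ne').hasDerivAt).mono_left
      (nhdsWithin_mono z fun t (ht : z < t) => ht.ne')
  filter_upwards [h.eventually_const_lt hd, self_mem_nhdsWithin] with t ht hzt
  rw [slope_def_field, hg, sub_zero] at ht
  exact (div_pos_iff_of_pos_right (sub_pos.2 hzt)).1 ht

/-- Near a point of the discriminant with nonzero `Δ`, some point `q` of the plane gives
`f (q, ·)` two distinct zeros close to each other, one of them being `z` itself. -/
theorem exists_near_double_zero {f : (ℝ × ℝ) × ℝ → ℝ} (hf : ContDiff ℝ (⊤ : ℕ∞) f)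
    {x y z : ℝ} (h0 : f ((x, y), z) = 0) (h1 : deriv (fun t => f ((x, y), t)) z = 0)
    (hdet : deriv (fun s => f ((s, y), z)) x *
          deriv (fun s => deriv (fun t => f ((x, s), t)) z) y -
        deriv (fun s => f ((x, s), z)) y *
          deriv (fun s => deriv (fun t => f ((s, y), t)) z) x ≠ 0) {ε : ℝ} (hε : 0 < ε) :
    ∃ (q : ℝ × ℝ) (t : ℝ), dist q (x, y) < ε ∧ dist t z < ε ∧ z ≠ t ∧
      f (q, z) = 0 ∧ f (q, t) = 0 := by
  have hz : ContDiff ℝ 1 fun q : ℝ × ℝ => (q, z) := contDiff_id.prodMk contDiff_const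
  obtain ⟨γ, hγ0, r, hr, hγc, hγ⟩ := exists_continuousOn_rightInverse
    (a := fun q => f (q, z)) (b := fun q => deriv (fun t => f (q, t)) z)
    ((hf.of_le (by norm_cast)).comp hz) ((contDiff_deriv_snd hf).comp hz) h0 h1 hdet
  have hnear : ∀ᶠ s in nhds (0 : ℝ), dist (γ s) (x, y) < ε := by
    have h := hγc.continuousAt (Metric.ball_mem_nhds 0 hr)
    rw [ContinuousAt, hγ0] at h
    exact h (Metric.ball_mem_nhds _ hε)
  obtain ⟨d, hd, hball⟩ := Metric.eventually_nhds_iff_ball.1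
    (hnear.and (Metric.ball_mem_nhds 0 hr))
  have hsub : ∀ s ∈ Set.Icc (-(d / 2)) (d / 2), s ∈ Metric.ball (0 : ℝ) d := by
    intro s hs
    rw [mem_ball_zero_iff, Real.norm_eq_abs, abs_lt]
    constructor <;> linarith [hs.1, hs.2]
  have hle : -(d / 2) ≤ d / 2 := by linarith
  have hright := hγ _ (hball _ (hsub _ (Set.right_mem_Icc.2 hle))).2
  have hleft := hγ _ (hball _ (hsub _ (Set.left_mem_Icc.2 hle))).2
  have hpos := eventually_pos_of_deriv_pos (g := fun t => f (γ (d / 2), t)) hright.1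
    (by rw [hright.2]; linarith)
  have hneg := eventually_pos_of_deriv_pos (g := fun t => -f (γ (-(d / 2)), t))
    (by rw [hleft.1, neg_zero]) (by rw [deriv.fun_neg, hleft.2]; linarith)
  obtain ⟨t, ⟨⟨htpos, htneg⟩, htz⟩, htε⟩ := (((hpos.and hneg).and self_mem_nhdsWithin).and
    (mem_nhdsWithin_of_mem_nhds (Metric.ball_mem_nhds z hε))).exists
  have hcont : ContinuousOn (fun s => f (γ s, t)) (Set.Icc (-(d / 2)) (d / 2)) :=
    hf.continuous.comp_continuousOn
      ((hγc.mono fun s hs => (hball s (hsub s hs)).2).prodMk continuousOn_const)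
  obtain ⟨s, hs, hst⟩ := intermediate_value_Icc hle hcont
    ⟨(neg_pos.1 htneg).le, htpos.le⟩
  have hsd := hball s (hsub s hs)
  exact ⟨γ s, t, hsd.1, htε, (ne_of_gt htz).symm, (hγ s hsd.2).1, hst⟩


/-- If `f` is smooth and at every point with `f = 0` and `f_z = 0` the
determinant `Δ = f_x f_{yz} - f_y f_{xz}` is nonzero, then the discriminant `𝒟` of the
family of plane curves `C_z = {q | f (q, z) = 0}` equals its envelope `ℰ`. -/
theorem discriminant_eq_envelope
    (f : (ℝ × ℝ) × ℝ → ℝ) (hf : ContDiff ℝ (⊤ : ℕ∞) f)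
    (hΔ : ∀ x y z : ℝ, f ((x, y), z) = 0 → deriv (fun t => f ((x, y), t)) z = 0 →
      deriv (fun s => f ((s, y), z)) x *
          deriv (fun s => deriv (fun t => f ((x, s), t)) z) y -
        deriv (fun s => f ((x, s), z)) y *
          deriv (fun s => deriv (fun t => f ((s, y), t)) z) x ≠ 0) :
    {q : ℝ × ℝ | ∃ z : ℝ, f (q, z) = 0 ∧ deriv (fun t => f (q, t)) z = 0} =
    {q : ℝ × ℝ | ∃ (qn : ℕ → ℝ × ℝ) (zn zn' : ℕ → ℝ) (zs : ℝ),
      Filter.Tendsto qn Filter.atTop (nhds q) ∧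
      Filter.Tendsto zn Filter.atTop (nhds zs) ∧
      Filter.Tendsto zn' Filter.atTop (nhds zs) ∧
      (∀ n, zn n ≠ zn' n) ∧
      (∀ n, f (qn n, zn n) = 0 ∧ f (qn n, zn' n) = 0)} := by
  ext ⟨x, y⟩
  constructor
  · rintro ⟨z, h0, h1⟩
    choose q t hq ht hne hfz hft using fun n : ℕ =>
      exists_near_double_zero hf h0 h1 (hΔ x y z h0 h1) (Nat.one_div_pos_of_nat (α := ℝ) (n := n))
    exact ⟨q, fun _ => z, t, z,
      tendsto_iff_dist_tendsto_zero.2 (squeeze_zero (fun _ => dist_nonneg) (fun n => (hq n).le)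
        tendsto_one_div_add_atTop_nhds_zero_nat),
      tendsto_const_nhds,
      tendsto_iff_dist_tendsto_zero.2 (squeeze_zero (fun _ => dist_nonneg) (fun n => (ht n).le)
        tendsto_one_div_add_atTop_nhds_zero_nat),
      hne, fun n => ⟨hfz n, hft n⟩⟩
  · rintro ⟨qn, zn, zn', zs, hq, hz, hz', hne, h0⟩
    exact ⟨zs, eq_zero_and_deriv_eq_zero_of_tendsto hf hq hz hz' hne h0⟩
end

section
/- (Bifurcation Lemma) Let f : ℝ × ℝ → ℝ be smooth (C^∞), with variables (λ, x), and suppose f(λ, 0) = 0 for all λ ∈ ℝ. If ∂f/∂x(λ*, 0) = 0 and ∂²f/∂λ∂x(λ*, 0) ≠ 0, then there exist δ > 0 and a smooth function λ : (−δ, δ) → ℝ such that λ(0) = λ* and f(λ(x), x) = 0 for all x ∈ (−δ, δ). -/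
open Set Filter Topology
open scoped ContDiff

universe u

theorem ContDiff.parametric_intervalIntegral_nat {E F : Type u}
    [NormedAddCommGroup E] [NormedSpace ℝ E] [ProperSpace E]
    [NormedAddCommGroup F] [NormedSpace ℝ F] [CompleteSpace F]
    (a b : ℝ) (n : ℕ) {G : E × ℝ → F} (hG : ContDiff ℝ n G) :
    ContDiff ℝ n (fun x => ∫ t in a..b, G (x, t)) := by
  induction n generalizing F with
  | zero =>
    rw [Nat.cast_zero, contDiff_zero] at hG ⊢
    exact intervalIntegral.continuous_parametric_intervalIntegral_of_continuous'
      (f := fun x t => G (x, t)) hG a b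
  | succ n ih =>
    push_cast at hG ⊢
    rw [contDiff_succ_iff_hasFDerivAt] at hG ⊢
    obtain ⟨G', hG', hGG'⟩ := hG
    have hcont : Continuous G :=
      continuous_iff_continuousAt.2 fun p => (hGG' p).continuousAt
    have hD : ContDiff ℝ n (fun p => (G' p).comp (ContinuousLinearMap.inl ℝ E ℝ)) :=
      hG'.clm_comp contDiff_const
    refine ⟨_, ih hD, fun x => ?_⟩
    obtain ⟨C, hC⟩ := ((isCompact_closedBall x 1).prod isCompact_uIcc).exists_bound_of_continuousOn
      (s := Metric.closedBall x 1 ×ˢ uIcc a b) hD.continuous.continuousOn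
    refine intervalIntegral.hasFDerivAt_integral_of_dominated_of_fderiv_le
      (𝕜 := ℝ) (μ := MeasureTheory.volume) (F := fun x t => G (x, t))
      (F' := fun x t => (G' (x, t)).comp (ContinuousLinearMap.inl ℝ E ℝ)) (bound := fun _ => C)
      (Metric.closedBall_mem_nhds x one_pos)
      (.of_forall fun y => ?_) ?_ ?_ ?_ intervalIntegrable_const ?_
    · exact (hcont.comp (by fun_prop)).aestronglyMeasurable
    · exact (hcont.comp (by fun_prop : Continuous fun t : ℝ => (x, t))).intervalIntegrable _ _
    · exact (hD.continuous.comp (by fun_prop : Continuous fun t : ℝ => (x, t))).aestronglyMeasurable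
    · exact .of_forall fun t ht y hy => hC (y, t) ⟨hy, uIoc_subset_uIcc ht⟩
    · exact .of_forall fun t _ y _ => (hGG' (y, t)).comp y (hasFDerivAt_prodMk_left y t)

/-- The integral of a smooth function over an interval depends smoothly on parameters. -/
theorem ContDiff.parametric_intervalIntegral_infty {E F : Type u}
    [NormedAddCommGroup E] [NormedSpace ℝ E] [ProperSpace E]
    [NormedAddCommGroup F] [NormedSpace ℝ F] [CompleteSpace F]
    (a b : ℝ) {G : E × ℝ → F} (hG : ContDiff ℝ ∞ G) :
    ContDiff ℝ ∞ (fun x => ∫ t in a..b, G (x, t)) :=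
  contDiff_infty.2 fun n => (contDiff_infty.1 hG n).parametric_intervalIntegral_nat a b n

theorem ContinuousLinearMap.isInvertible_of_apply_one_ne_zero {𝕜 : Type*}
    [NontriviallyNormedField 𝕜] {L : 𝕜 →L[𝕜] 𝕜} (h : L 1 ≠ 0) : L.IsInvertible := by
  refine .of_inverse (g := (L 1)⁻¹ • ContinuousLinearMap.id 𝕜 𝕜) ?_ ?_ <;> ext <;> simp [h]

/-- Hadamard's lemma with a parameter: a smooth function vanishing on `{x = 0}` is `x` times a
smooth function. -/
theorem exists_contDiff_eq_mul_of_eq_zero {f : ℝ × ℝ → ℝ} (hf : ContDiff ℝ ∞ f)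
    (h0 : ∀ l, f (l, 0) = 0) :
    ∃ g : ℝ × ℝ → ℝ, ContDiff ℝ ∞ g ∧ (∀ x l, f (l, x) = x * g (x, l)) ∧
      ∀ l, g (0, l) = deriv (fun x => f (l, x)) 0 := by
  have hderiv : ∀ l x, HasDerivAt (fun x => f (l, x)) (fderiv ℝ f (l, x) (0, 1)) x := fun l x =>
    (hf.differentiable (by simp) (l, x)).hasFDerivAt.comp_hasDerivAt x
      ((hasDerivAt_const x l).prodMk (hasDerivAt_id x))
  have hD : ContDiff ℝ ∞ fun p => fderiv ℝ f p (0, 1) :=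
    (hf.fderiv_right (m := ∞) (by simp)).clm_apply contDiff_const
  have hG : ContDiff ℝ ∞ fun q : (ℝ × ℝ) × ℝ => fderiv ℝ f (q.1.2, q.2 * q.1.1) (0, 1) :=
    hD.comp (g := fun p => fderiv ℝ f p (0, 1)) (by fun_prop)
  refine ⟨_, hG.parametric_intervalIntegral_infty 0 1, fun x l => ?_, fun l => ?_⟩
  · have h := intervalIntegral.integral_eq_sub_of_hasDerivAt (a := 0) (b := 1)
      (f := fun t => f (l, t * x)) (f' := fun t => fderiv ℝ f (l, t * x) (0, 1) * x)
      (fun t _ => by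
        simpa [Function.comp_def] using (hderiv l (t * x)).comp t ((hasDerivAt_id t).mul_const x))
      (((hD.continuous.comp
        (by fun_prop : Continuous fun t : ℝ => (l, t * x))).mul_const x).intervalIntegrable _ _)
    rw [intervalIntegral.integral_mul_const] at h
    simp only [one_mul, zero_mul, h0, sub_zero] at h
    rw [← h, mul_comm]
  · simp [(hderiv l 0).deriv]

/-- Implicit function theorem for a smooth equation in the plane, with a solution that is smooth
on a whole interval. -/
theorem exists_contDiffOn_implicit {g : ℝ × ℝ → ℝ} (hg : ContDiff ℝ ∞ g) {a b : ℝ}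
    (h0 : g (a, b) = 0) (h1 : fderiv ℝ g (a, b) (0, 1) ≠ 0) :
    ∃ δ > (0 : ℝ), ∃ ψ : ℝ → ℝ, ContDiffOn ℝ ∞ ψ (Ioo (a - δ) (a + δ)) ∧ ψ a = b ∧
      ∀ x ∈ Ioo (a - δ) (a + δ), g (x, ψ x) = 0 := by
  have hinv : ∀ {u}, fderiv ℝ g u (0, 1) ≠ 0 →
      (fderiv ℝ g u ∘L .inr ℝ ℝ ℝ).IsInvertible := fun h =>
    ContinuousLinearMap.isInvertible_of_apply_one_ne_zero (by simpa using h)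
  have hD : Continuous fun p => fderiv ℝ g p (0, 1) :=
    (hg.continuous_fderiv (by simp)).clm_apply continuous_const
  have htop : (∞ : WithTop ℕ∞) ≠ 0 := by simp
  set ψ := hg.contDiffAt.implicitFunction htop (hinv h1)
  have hψa : ψ a = b := hg.contDiffAt.implicitFunction_apply_self htop (hinv h1)
  have hsm : ContDiffAt ℝ ∞ ψ a := hg.contDiffAt.contDiffAt_implicitFunction htop (hinv h1)
  have hzero : ∀ᶠ x in 𝓝 a, g (x, ψ x) = 0 := by
    simpa only [h0] using hg.contDiffAt.eventually_apply_implicitFunction htop (hinv h1)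
  have hcont : ∀ᶠ x in 𝓝 a, ContinuousAt ψ x :=
    ((hsm.of_le (m := 1) (by simp)).eventually (by simp)).mono fun x h => h.continuousAt
  have hne : ∀ᶠ x in 𝓝 a, fderiv ℝ g (x, ψ x) (0, 1) ≠ 0 := by
    have : ContinuousAt (fun x => fderiv ℝ g (x, ψ x) (0, 1)) a :=
      hD.continuousAt.comp (continuousAt_id.prodMk hsm.continuousAt)
    exact this.eventually_ne (by simpa only [hψa] using h1)
  have hall : ∀ᶠ x in 𝓝 a, g (x, ψ x) = 0 ∧ ContDiffAt ℝ ∞ ψ x := by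
    filter_upwards [hzero.eventually_nhds, hcont, hne] with x hx hcx hnx
    refine ⟨hx.self_of_nhds, ?_⟩
    refine (hg.contDiffAt.contDiffAt_implicitFunction htop (hinv hnx)).congr_of_eventuallyEq ?_
    have htend : Tendsto (fun y => (y, ψ y)) (𝓝 x) (𝓝 (x, ψ x)) :=
      continuousAt_id.prodMk hcx
    filter_upwards [hx, htend.eventually
      (hg.contDiffAt.eventually_apply_eq_iff_implicitFunction htop (hinv hnx))] with y hy hiff
    exact (hiff.1 (hy.trans hx.self_of_nhds.symm)).symm
  obtain ⟨δ, hδ, hball⟩ := Metric.eventually_nhds_iff_ball.1 hall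
  rw [Real.ball_eq_Ioo] at hball
  exact ⟨δ, hδ, ψ, fun x hx => (hball x hx).2.contDiffWithinAt, hψa, fun x hx => (hball x hx).1⟩

/-- Bifurcation Lemma. Let `f : ℝ × ℝ → ℝ` be smooth with `f (λ, 0) = 0`
for all `λ`. If `∂f/∂x (λ*, 0) = 0` and `∂²f/∂λ∂x (λ*, 0) ≠ 0`, then there are `δ > 0`
and a smooth function `lam : (-δ, δ) → ℝ` with `lam 0 = λ*` and `f (lam x, x) = 0`
for all `x ∈ (-δ, δ)`. -/
theorem bifurcation_lemma
    (f : ℝ × ℝ → ℝ) (hf : ContDiff ℝ (⊤ : ℕ∞) f) (lamStar : ℝ)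
    (htriv : ∀ lam : ℝ, f (lam, 0) = 0)
    (hx : deriv (fun x => f (lamStar, x)) 0 = 0)
    (hlx : deriv (fun lam => deriv (fun x => f (lam, x)) 0) lamStar ≠ 0) :
    ∃ δ > (0 : ℝ), ∃ lam : ℝ → ℝ,
      ContDiffOn ℝ (⊤ : ℕ∞) lam (Set.Ioo (-δ) δ) ∧ lam 0 = lamStar ∧
      ∀ x ∈ Set.Ioo (-δ) δ, f (lam x, x) = 0 := by
  obtain ⟨g, hg, hfg, hg0⟩ := exists_contDiff_eq_mul_of_eq_zero hf htriv
  have hder : fderiv ℝ g (0, lamStar) (0, 1) ≠ 0 := by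
    have h : HasDerivAt (fun l => g (0, l)) (fderiv ℝ g (0, lamStar) (0, 1)) lamStar :=
      (hg.differentiable (by simp) (0, lamStar)).hasFDerivAt.comp_hasDerivAt lamStar
        ((hasDerivAt_const lamStar 0).prodMk (hasDerivAt_id lamStar))
    rwa [← h.deriv, funext hg0]
  obtain ⟨δ, hδ, lam, hsm, h0, hsol⟩ := exists_contDiffOn_implicit hg ((hg0 _).trans hx) hder
  rw [zero_sub, zero_add] at hsm hsol
  exact ⟨δ, hδ, lam, hsm, h0, fun x hx => by rw [hfg, hsol x hx, mul_zero]⟩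
end

section
/- (Krasnoselskij Principle) Let h : [0,1] × ℝⁿ → ℝⁿ be continuously differentiable with h(λ, 0) = 0 for all λ ∈ [0,1]. Write D_x h(λ, x) : ℝⁿ → ℝⁿ for the partial derivative in the second variable. If D_x h(0, 0) and D_x h(1, 0) are invertible and det D_x h(0,0) and det D_x h(1,0) have opposite signs, then there exists a bifurcation point λ* ∈ (0,1) from the trivial branch: every neighbourhood of (λ*, 0) in [0,1] × ℝⁿ contains a point (λ, x) with x ≠ 0 and h(λ, x) = 0. -/
open Set Filter Topology MeasureTheory

/-- The determinant of the matrix with rows `v i`, as a continuous alternating map. -/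
noncomputable def detForm (n : ℕ) : (Fin n → ℝ) [⋀^Fin n]→L[ℝ] ℝ where
  toMultilinearMap := (Matrix.detRowAlternating (R := ℝ) (n := Fin n)).toMultilinearMap
  map_eq_zero_of_eq' := (Matrix.detRowAlternating (R := ℝ) (n := Fin n)).map_eq_zero_of_eq'
  cont := Continuous.matrix_det (A := fun v : Fin n → Fin n → ℝ => Matrix.of v) continuous_id

lemma detForm_apply {n : ℕ} (v : Fin n → Fin n → ℝ) : detForm n v = (Matrix.of v).det := rfl

lemma detForm_apply_clm {n : ℕ} (L : (Fin n → ℝ) →L[ℝ] (Fin n → ℝ)) :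
    detForm n (fun j => L (Pi.single j 1)) = L.det := by
  rw [detForm_apply, ContinuousLinearMap.det, ← LinearMap.det_toMatrix', ← Matrix.det_transpose]
  congr 1

/-- Stokes' theorem on a box for a closed differential form of codimension one. -/
lemma sum_integral_faces_eq_zero_of_extDeriv_eq_zero {n : ℕ}
    {ω : (Fin (n + 1) → ℝ) → (Fin (n + 1) → ℝ) [⋀^Fin n]→L[ℝ] ℝ}
    (hω : Differentiable ℝ ω) (hd : ∀ z, extDeriv ω z = 0)
    {a b : Fin (n + 1) → ℝ} (hab : a ≤ b) :
    ∑ i : Fin (n + 1),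
      ((∫ x in Icc (a ∘ i.succAbove) (b ∘ i.succAbove), (-1 : ℝ) ^ (i : ℕ) *
          ω (i.insertNth (b i) x) (fun j => Pi.single (i.succAbove j) 1)) -
        ∫ x in Icc (a ∘ i.succAbove) (b ∘ i.succAbove), (-1 : ℝ) ^ (i : ℕ) *
          ω (i.insertNth (a i) x) (fun j => Pi.single (i.succAbove j) 1)) = 0 := by
  have hdiff : ∀ v : Fin n → Fin (n + 1) → ℝ, Differentiable ℝ fun z => ω z v := fun v z =>
    ((hω z).hasFDerivAt.continuousAlternatingMap_apply
      (fun i => hasFDerivAt_const (v i) z)).differentiableAt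
  have hdiv : ∀ z, ∑ i : Fin (n + 1), ((-1 : ℝ) ^ (i : ℕ) •
      fderiv ℝ (fun z => ω z (fun j => Pi.single (i.succAbove j) 1)) z) (Pi.single i 1) = 0 := by
    intro z
    have := extDeriv_apply (hω z) (fun j => Pi.single j 1)
    rw [hd] at this
    change _ = ∑ i : Fin (n + 1), (-1 : ℤ) ^ (i : ℕ) •
      fderiv ℝ (fun z => ω z fun j => Pi.single (i.succAbove j) 1) z (Pi.single i 1) at this
    simpa using this.symm
  have key := integral_divergence_of_hasFDerivAt_off_countable' a b hab
    (fun i z => (-1 : ℝ) ^ (i : ℕ) * ω z (fun j => Pi.single (i.succAbove j) 1))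
    (fun i z => (-1 : ℝ) ^ (i : ℕ) • fderiv ℝ (fun z => ω z (fun j => Pi.single (i.succAbove j) 1)) z)
    ∅ countable_empty (fun i => ((hdiff _).continuous.const_mul _).continuousOn)
    (fun z _ i => ((hdiff _) z).hasFDerivAt.const_mul _)
    (by simp only [hdiv]; exact integrableOn_zero)
  simp only [hdiv, integral_zero] at key
  exact key.symm

/-- A form of top degree is closed, hence so is its pullback. -/
lemma extDeriv_pullback_eq_zero {m n : ℕ}
    {η : (Fin n → ℝ) → (Fin n → ℝ) [⋀^Fin n]→L[ℝ] ℝ} (hη : Differentiable ℝ η)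
    {G : (Fin m → ℝ) → Fin n → ℝ} (hG : ContDiff ℝ 2 G) (z : Fin m → ℝ) :
    extDeriv (fun z => (η (G z)).compContinuousLinearMap (fderiv ℝ G z)) z = 0 := by
  rw [extDeriv_pullback (hη _) hG.contDiffAt (by simp)]
  ext v
  rw [ContinuousAlternatingMap.compContinuousLinearMap_apply]
  refine AlternatingMap.map_linearDependent (extDeriv η (G z)).toAlternatingMap _ fun hli => ?_
  have := hli.fintype_card_le_finrank
  simp at this

/-- Homotopy invariance of the integral computing the weighted degree of a map on the cube. -/
lemma integral_mul_det_fderiv_eq_of_homotopy {n : ℕ} {F : ℝ × (Fin n → ℝ) → Fin n → ℝ}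
    (hF : ContDiff ℝ 2 F) {φ : (Fin n → ℝ) → ℝ} (hφ : Differentiable ℝ φ) {r : ℝ} (hr : 0 ≤ r)
    (hbd : ∀ t ∈ Icc (0 : ℝ) 1, ∀ x, ‖x‖ = r → φ (F (t, x)) = 0) :
    ∫ x in Icc (fun _ => -r) (fun _ => r),
        φ (F (0, x)) * (fderiv ℝ (fun x => F (0, x)) x).det =
      ∫ x in Icc (fun _ => -r) (fun _ => r),
        φ (F (1, x)) * (fderiv ℝ (fun x => F (1, x)) x).det := by
  let G : (Fin (n + 1) → ℝ) → Fin n → ℝ := fun z => F (z 0, Fin.tail z)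
  have hG : ContDiff ℝ 2 G := by
    refine hF.comp (ContDiff.prodMk (contDiff_apply ℝ ℝ 0) ?_)
    exact contDiff_pi.2 fun i => contDiff_apply ℝ ℝ i.succ
  have hη : Differentiable ℝ fun y => φ y • detForm n := hφ.smul_const _
  have hω : Differentiable ℝ fun z =>
      (φ (G z) • detForm n).compContinuousLinearMap (fderiv ℝ G z) := fun z =>
    DifferentiableAt.continuousAlternatingMapCompContinuousLinearMap
      ((hη (G z)).comp z (hG.differentiable (by norm_num) z))
      ((hG.fderiv_right (m := 1) (by norm_num)).differentiable (by norm_num) z)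
  have hle : (Fin.cons 0 fun _ => -r : Fin (n + 1) → ℝ) ≤ Fin.cons 1 fun _ => r := by
    intro i
    refine Fin.cases ?_ (fun j => ?_) i
    · simp
    · simp only [Fin.cons_succ]; linarith
  have key := sum_integral_faces_eq_zero_of_extDeriv_eq_zero hω
    (extDeriv_pullback_eq_zero hη hG) hle
  have hslice : ∀ (s : ℝ) (x : Fin n → ℝ),
      ((φ (G (Fin.cons s x)) • detForm n).compContinuousLinearMap (fderiv ℝ G (Fin.cons s x)))
        (fun j => Pi.single j.succ 1) =
      φ (F (s, x)) * (fderiv ℝ (fun x => F (s, x)) x).det := by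
    intro s x
    have hι : HasFDerivAt (fun x : Fin n → ℝ => (Fin.cons s x : Fin (n + 1) → ℝ))
        (ContinuousLinearMap.pi (Fin.cons 0 fun i => ContinuousLinearMap.proj (R := ℝ) i)) x := by
      refine hasFDerivAt_pi.2 fun i => ?_
      refine Fin.cases ?_ (fun j => ?_) i
      · simpa using hasFDerivAt_const s x
      · simpa using hasFDerivAt_apply j x
    have hcomp : HasFDerivAt (fun x => F (s, x)) _ x :=
      ((hG.differentiable (by norm_num) (Fin.cons s x)).hasFDerivAt.comp x hι)
    rw [hcomp.fderiv, ← detForm_apply_clm]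
    simp only [ContinuousAlternatingMap.compContinuousLinearMap_apply,
      ContinuousAlternatingMap.smul_apply, smul_eq_mul]
    refine congrArg (fun v => φ (F (s, x)) * detForm n v) (funext fun j => ?_)
    rw [Function.comp_apply, ContinuousLinearMap.comp_apply]
    congr 1
    ext i
    refine Fin.cases ?_ (fun l => ?_) i
    · simp
    · simp [Pi.single_apply]
  have hside : ∀ (i : Fin n) (c : ℝ), |c| = r → ∀ x ∈ Icc
      ((Fin.cons 0 fun _ => -r : Fin (n + 1) → ℝ) ∘ i.succ.succAbove)
      ((Fin.cons 1 fun _ => r : Fin (n + 1) → ℝ) ∘ i.succ.succAbove),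
      φ (G (i.succ.insertNth c x)) = 0 := by
    intro i c hc x hx
    have hz : ∀ j, (i.succ.insertNth c x : Fin (n + 1) → ℝ) j ∈
        Icc ((Fin.cons 0 fun _ => -r : Fin (n + 1) → ℝ) j)
          ((Fin.cons 1 fun _ => r : Fin (n + 1) → ℝ) j) := by
      intro j
      refine Fin.succAboveCases i.succ ?_ (fun k => ?_) j
      · simpa [← abs_le] using hc.le
      · simpa using ⟨hx.1 k, hx.2 k⟩
    refine hbd _ (by simpa using hz 0) _ (le_antisymm ?_ ?_)
    · exact (pi_norm_le_iff_of_nonneg hr).2 fun j => by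
        simpa [Fin.tail, Real.norm_eq_abs, abs_le] using hz j.succ
    · refine le_trans ?_ (norm_le_pi_norm _ i)
      simp [Fin.tail, hc]
  rw [Fin.sum_univ_succ, Finset.sum_eq_zero fun i _ => ?_, add_zero, sub_eq_zero] at key
  · simp only [Fin.insertNth_zero', Fin.zero_succAbove, Fin.cons_zero, hslice, Fin.val_zero,
      pow_zero, one_mul] at key
    exact key.symm
  · rw [setIntegral_eq_zero_of_forall_eq_zero, setIntegral_eq_zero_of_forall_eq_zero, sub_zero]
    · intro x hx
      simp [hside i (-r) (by rw [abs_neg, abs_of_nonneg hr]) x hx]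
    · intro x hx
      simp [hside i r (abs_of_nonneg hr) x hx]

lemma integral_comp_clm_pos {n : ℕ} (A : (Fin n → ℝ) →L[ℝ] (Fin n → ℝ)) {r : ℝ} (hr : 0 < r)
    {φ : (Fin n → ℝ) → ℝ} (hφ : Continuous φ) (hφ0 : 0 < φ 0) (hnn : ∀ y, 0 ≤ φ y) :
    0 < ∫ x in Icc (fun _ : Fin n => -r) (fun _ => r), φ (A x) := by
  have hc : Continuous fun x => φ (A x) := hφ.comp A.continuous
  rw [setIntegral_pos_iff_support_of_nonneg_ae (ae_of_all _ fun x => hnn _)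
    (hc.continuousOn.integrableOn_compact isCompact_Icc)]
  refine Measure.measure_pos_of_mem_nhds (x := (0 : Fin n → ℝ)) _ (inter_mem ?_ ?_)
  · exact hc.isOpen_support.mem_nhds (by simpa using hφ0.ne')
  · exact pi_Icc_mem_nhds (fun _ => by simpa using hr) (fun _ => by simpa using hr)

lemma exists_forall_mul_norm_le_of_det_ne_zero {n : ℕ} {A : (Fin n → ℝ) →L[ℝ] (Fin n → ℝ)}
    (hA : A.det ≠ 0) : ∃ c > 0, ∀ x, c * ‖x‖ ≤ ‖A x‖ := by
  have hker : LinearMap.ker (A : (Fin n → ℝ) →ₗ[ℝ] (Fin n → ℝ)) = ⊥ :=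
    LinearMap.ker_eq_bot.2 ((LinearMap.equivOfDetNeZero _ hA).injective)
  obtain ⟨K, hK, h⟩ := LinearMap.exists_antilipschitzWith _ hker
  have hK' : (0 : ℝ) < K := hK
  refine ⟨(K : ℝ)⁻¹, by positivity, fun x => ?_⟩
  rw [inv_mul_le_iff₀ hK']
  simpa using h.le_mul_dist x 0

/-- Near a parameter `s`, the map `x ↦ h (t, x)` is uniformly approximated by its linearization
at `(s, 0)`. -/
lemma eventually_norm_sub_fderiv_le {n : ℕ} {h : ℝ × (Fin n → ℝ) → Fin n → ℝ}
    (hh : ContDiff ℝ 1 h) (htriv : ∀ t ∈ Icc (0 : ℝ) 1, h (t, 0) = 0) (s : ℝ)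
    {c : ℝ} (hc : 0 < c) :
    ∀ᶠ p in 𝓝 (s, (0 : Fin n → ℝ)), p.1 ∈ Icc (0 : ℝ) 1 →
      ‖h p - fderiv ℝ (fun x => h (s, x)) 0 p.2‖ ≤ c * ‖p.2‖ := by
  have hs : HasStrictFDerivAt h (fderiv ℝ h (s, 0)) (s, 0) :=
    hh.contDiffAt.hasStrictFDerivAt (by norm_num)
  have hA : fderiv ℝ (fun x => h (s, x)) 0 =
      (fderiv ℝ h (s, 0)).comp (ContinuousLinearMap.inr ℝ ℝ (Fin n → ℝ)) :=
    (hs.hasFDerivAt.comp 0 (hasFDerivAt_prodMk_right s (0 : Fin n → ℝ))).fderiv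
  have ht : Tendsto (fun p : ℝ × (Fin n → ℝ) => (p, (p.1, (0 : Fin n → ℝ)))) (𝓝 (s, 0))
      (𝓝 ((s, 0), (s, 0))) := by
    have : Continuous fun p : ℝ × (Fin n → ℝ) => (p, (p.1, (0 : Fin n → ℝ))) := by fun_prop
    exact this.tendsto' _ _ rfl
  filter_upwards [ht.eventually (hs.isLittleO.bound hc)] with p hp hp1
  have hsub : p - (p.1, 0) = (0, p.2) := by ext <;> simp
  simpa [htriv _ hp1, hA, hsub, Prod.norm_mk] using hp

/-- If a smooth `g` is close to a linear `A` on the sphere of radius `r`, then `A` and `g` have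
the same weighted degree on the cube of radius `r`. -/
lemma integral_mul_det_eq_of_norm_sub_le {n : ℕ} {g : (Fin n → ℝ) → Fin n → ℝ}
    (hg : ContDiff ℝ 2 g) (A : (Fin n → ℝ) →L[ℝ] (Fin n → ℝ)) {φ : (Fin n → ℝ) → ℝ}
    (hφ : Differentiable ℝ φ) {r ε : ℝ} (hr : 0 ≤ r) (hφε : ∀ y, ε ≤ ‖y‖ → φ y = 0)
    (hclose : ∀ x, ‖x‖ = r → ‖g x - A x‖ + ε ≤ ‖A x‖) :
    A.det * ∫ x in Icc (fun _ => -r) (fun _ => r), φ (A x) =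
      ∫ x in Icc (fun _ => -r) (fun _ => r), φ (g x) * (fderiv ℝ g x).det := by
  have hF : ContDiff ℝ 2 fun p : ℝ × (Fin n → ℝ) => A p.2 + p.1 • (g p.2 - A p.2) := by fun_prop
  have := integral_mul_det_fderiv_eq_of_homotopy hF hφ hr fun t ht x hx => hφε _ ?_
  · simpa [integral_mul_const, mul_comm] using this
  · have h1 := norm_sub_le_norm_add (A x) (t • (g x - A x))
    have h2 : ‖t • (g x - A x)‖ ≤ ‖g x - A x‖ := by
      rw [norm_smul, Real.norm_of_nonneg ht.1]
      exact mul_le_of_le_one_left (norm_nonneg _) ht.2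
    have := hclose x hx
    simp only
    linarith

/-- Krasnoselskij Principle. Let `h : ℝ × ℝⁿ → ℝⁿ` be continuously
differentiable with `h (λ, 0) = 0` for `λ ∈ [0,1]`.  If the partial differentials
`D_x h(0,0)` and `D_x h(1,0)` are invertible with determinants of opposite signs, then
there is a bifurcation point `λ* ∈ (0,1)` from the trivial branch: every neighbourhood
of `(λ*, 0)` contains a point `(λ, x)` with `λ ∈ [0,1]`, `x ≠ 0` and `h (λ, x) = 0`. -/
theorem krasnoselskij_principle
    (n : ℕ) (h : ℝ × (Fin n → ℝ) → (Fin n → ℝ))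
    (hh : ContDiff ℝ 1 h)
    (htriv : ∀ lam ∈ Set.Icc (0 : ℝ) 1, h (lam, 0) = 0)
    (hinv0 : (fderiv ℝ (fun x => h (0, x)) 0).det ≠ 0)
    (hinv1 : (fderiv ℝ (fun x => h (1, x)) 0).det ≠ 0)
    (hsign : (fderiv ℝ (fun x => h (0, x)) 0).det *
      (fderiv ℝ (fun x => h (1, x)) 0).det < 0) :
    ∃ lamStar ∈ Set.Ioo (0 : ℝ) 1,
      ∀ U ∈ nhds (lamStar, (0 : Fin n → ℝ)),
        ∃ lam : ℝ, ∃ x : Fin n → ℝ,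
          (lam, x) ∈ U ∧ lam ∈ Set.Icc (0 : ℝ) 1 ∧ x ≠ 0 ∧ h (lam, x) = 0 := by

  by_contra! hcon
  set A₀ := fderiv ℝ (fun x => h (0, x)) 0
  set A₁ := fderiv ℝ (fun x => h (1, x)) 0
  obtain ⟨c₀, hc₀, hA₀⟩ := exists_forall_mul_norm_le_of_det_ne_zero hinv0
  obtain ⟨c₁, hc₁, hA₁⟩ := exists_forall_mul_norm_le_of_det_ne_zero hinv1
  have hlin₀ := eventually_norm_sub_fderiv_le hh htriv 0 (half_pos hc₀)
  have hlin₁ := eventually_norm_sub_fderiv_le hh htriv 1 (half_pos hc₁)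
  have hisol_of_lin : ∀ {p : ℝ × (Fin n → ℝ)} {A : (Fin n → ℝ) →L[ℝ] (Fin n → ℝ)} {c : ℝ},
      0 < c → (∀ x, c * ‖x‖ ≤ ‖A x‖) → ‖h p - A p.2‖ ≤ c / 2 * ‖p.2‖ → p.2 ≠ 0 → h p ≠ 0 := by
    intro p A c hc hA hp hp2 h0
    rw [h0, zero_sub, norm_neg] at hp
    have := mul_pos hc (norm_pos_iff.2 hp2)
    linarith [hA p.2]
  have hisol : ∀ s ∈ Icc (0 : ℝ) 1, ∀ᶠ p in 𝓝 (s, (0 : Fin n → ℝ)),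
      p.1 ∈ Icc (0 : ℝ) 1 → p.2 ≠ 0 → h p ≠ 0 := by
    intro s hs
    rcases eq_or_lt_of_le hs.1 with rfl | hs0
    · filter_upwards [hlin₀] with p hp hp1 using hisol_of_lin hc₀ hA₀ (hp hp1)
    rcases eq_or_lt_of_le hs.2 with rfl | hs1
    · filter_upwards [hlin₁] with p hp hp1 using hisol_of_lin hc₁ hA₁ (hp hp1)
    obtain ⟨U, hU, hU'⟩ := hcon s ⟨hs0, hs1⟩
    filter_upwards [hU] with p hp hp1 hp2 using hU' p.1 p.2 hp hp1 hp2
  have hunif : ∀ᶠ x in 𝓝 (0 : Fin n → ℝ), ∀ t ∈ Icc (0 : ℝ) 1, x ≠ 0 → h (t, x) ≠ 0 := by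
    have := (isCompact_Icc (a := (0 : ℝ)) (b := 1)).eventually_forall_of_forall_eventually
      (x₀ := (0 : Fin n → ℝ)) (P := fun x t => t ∈ Icc (0 : ℝ) 1 → x ≠ 0 → h (t, x) ≠ 0)
      fun s hs => (continuous_swap.tendsto ((0 : Fin n → ℝ), s)).eventually (hisol s hs)
    filter_upwards [this] with x hx t ht using hx t ht ht
  have hpair : ∀ s : ℝ, Tendsto (fun x : Fin n → ℝ => (s, x)) (𝓝 0) (𝓝 (s, 0)) := fun s =>
    (Continuous.prodMk_right s).tendsto' _ _ rfl
  obtain ⟨r, hr, hball⟩ := Metric.nhds_basis_closedBall.eventually_iff.1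
    (hunif.and (((hpair 0).eventually hlin₀).and ((hpair 1).eventually hlin₁)))
  replace hball : ∀ x : Fin n → ℝ, ‖x‖ = r → (∀ t ∈ Icc (0 : ℝ) 1, h (t, x) ≠ 0) ∧
      ‖h (0, x) - A₀ x‖ ≤ c₀ / 2 * r ∧ ‖h (1, x) - A₁ x‖ ≤ c₁ / 2 * r := by
    intro x hx
    obtain ⟨h1, h2, h3⟩ := hball (mem_closedBall_zero_iff.2 hx.le)
    rw [hx] at h2 h3
    exact ⟨fun t ht => h1 t ht (norm_pos_iff.1 (hx ▸ hr)), h2 (by simp), h3 (by simp)⟩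
  obtain ⟨δ, hδ, hδh⟩ := (isCompact_Icc.prod (isCompact_sphere (0 : Fin n → ℝ) r)).exists_forall_le'
    (f := fun p : ℝ × (Fin n → ℝ) => ‖h p‖) hh.continuous.norm.continuousOn (a := 0)
    fun p hp => norm_pos_iff.2 ((hball p.2 (mem_sphere_zero_iff_norm.1 hp.2)).1 p.1 hp.1)
  obtain ⟨ε, hε, hεδ, hε₀, hε₁⟩ : ∃ ε > 0, 2 * ε ≤ δ ∧ 2 * ε ≤ c₀ / 2 * r ∧ 2 * ε ≤ c₁ / 2 * r := by
    refine ⟨min δ (min (c₀ / 2 * r) (c₁ / 2 * r)) / 2, by positivity, ?_, ?_, ?_⟩ <;>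
      rw [mul_div_cancel₀ _ two_ne_zero] <;> simp
  obtain ⟨g, hg, hgh, -⟩ := hh.continuous.exists_contDiff_approx 2 continuous_const fun _ => hε
  replace hgh : ∀ p, ‖g p - h p‖ < ε := fun p => by simpa [dist_eq_norm] using hgh p
  have hg2 : ContDiff ℝ 2 g := hg
  let φ : ContDiffBump (0 : Fin n → ℝ) := ⟨ε / 2, ε, half_pos hε, half_lt_self hε⟩
  have hφε : ∀ y, ε ≤ ‖y‖ → φ y = 0 := fun y hy => φ.zero_of_le_dist (by simpa using hy)
  have hφ : Differentiable ℝ φ := (φ.contDiff (n := 1)).differentiable (by norm_num)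
  have hφ0 : 0 < φ 0 := φ.pos_of_mem_ball (by simpa using hε)
  have hend : ∀ {s c : ℝ} {A : (Fin n → ℝ) →L[ℝ] (Fin n → ℝ)}, (∀ x, c * ‖x‖ ≤ ‖A x‖) →
      2 * ε ≤ c / 2 * r → (∀ x, ‖x‖ = r → ‖h (s, x) - A x‖ ≤ c / 2 * r) →
      A.det * ∫ x in Icc (fun _ => -r) (fun _ => r), φ (A x) =
        ∫ x in Icc (fun _ => -r) (fun _ => r),
          φ (g (s, x)) * (fderiv ℝ (fun x => g (s, x)) x).det := by
    intro s c A hA hεc hclose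
    refine integral_mul_det_eq_of_norm_sub_le (by fun_prop) A hφ hr.le hφε fun x hx => ?_
    have h1 := norm_sub_le_norm_sub_add_norm_sub (g (s, x)) (h (s, x)) (A x)
    have h2 := hA x
    rw [hx] at h2
    linarith [hgh (s, x), hclose x hx]
  have hmid := integral_mul_det_fderiv_eq_of_homotopy hg2 hφ hr.le fun t ht x hx => hφε _ <| by
    have h1 := norm_sub_le_norm_sub_add_norm_sub (h (t, x)) (g (t, x)) 0
    have h2 := hδh (t, x) ⟨ht, mem_sphere_zero_iff_norm.2 hx⟩
    have h3 := hgh (t, x)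
    rw [norm_sub_rev] at h3
    simp only [sub_zero] at h1
    linarith
  rw [← hend hA₀ hε₀ fun x hx => (hball x hx).2.1,
    ← hend hA₁ hε₁ fun x hx => (hball x hx).2.2] at hmid
  have hI₀ := integral_comp_clm_pos A₀ hr φ.continuous hφ0 fun y => φ.nonneg
  have hI₁ := integral_comp_clm_pos A₁ hr φ.continuous hφ0 fun y => φ.nonneg
  rcases mul_neg_iff.1 hsign with ⟨h0, h1⟩ | ⟨h0, h1⟩
  · linarith [mul_pos h0 hI₀, mul_neg_of_neg_of_pos h1 hI₁]
  · linarith [mul_pos h1 hI₁, mul_neg_of_neg_of_pos h0 hI₀]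
end
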